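/- Let n be a nonnegative integer and let a, c ∈ ℂ. Set v = (c+n−an)/(2a+2c+n−1), and assume 2a+2c+n−1 ≠ 0, c+n−an ≠ 0, v + j ≠ 0 for 0 ≤ j ≤ ⌊n/2⌋−1, c+1+j ≠ 0 for 0 ≤ j ≤ n−1, and 1−c−n+j ≠ 0 for 0 ≤ j ≤ ⌊n/2⌋−1. Then Σ_{k=0}^{⌊n/2⌋} (−n/2)_k ((1−n)/2)_k (1+v)_k (a)_k (1−a)_k / ((3/2)_k (v)_k (c+1)_k (1−c−n)_k · k!) = ((c+n)/(c+n−an)) · (c+1−a)_n/(c+1)_n. (Terminating balanced ₅F₄-series identity; the left-hand side is ₅F₄[−n/2, (1−n)/2, 1+(c+n−an)/(2a+2c+n−1), a, 1−a; 3/2, (c+n−an)/(2a+2c+n−1), c+1, 1−c−n; 1].) -/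

import Mathlib

/-- Rising factorial (Pochhammer symbol) of a complex number:
`poch x 0 = 1` and `poch x (m+1) = poch x m * (x + m)`. -/
noncomputable def poch (x : ℂ) : ℕ → ℂ
  | 0 => 1
  | m + 1 => poch x m * (x + (m : ℂ))

theorem poch_succ_left (x : ℂ) (m : ℕ) : poch x (m + 1) = x * poch (x + 1) m := by
  induction m with
  | zero => simp [poch]
  | succ m ih =>
    rw [poch, ih, poch]; push_cast; ring

theorem poch_add (x : ℂ) (m k : ℕ) : poch x (m + k) = poch x m * poch (x + m) k := by
  induction k with
  | zero => simp [poch]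
  | succ k ih =>
    rw [← add_assoc, poch, ih, poch]; push_cast; ring

theorem poch_ne_zero (x : ℂ) (m : ℕ) (h : ∀ j : ℕ, j < m → x + j ≠ 0) : poch x m ≠ 0 := by
  induction m with
  | zero => simp [poch]
  | succ m ih =>
    rw [poch]
    exact mul_ne_zero (ih fun j hj => h j (by omega)) (h m (by omega))

theorem poch_nabla (y : ℂ) (m : ℕ) :
    poch y (m + 1) - poch (y - 1) (m + 1) = ((m : ℂ) + 1) * poch y m := by
  rw [poch_succ_left (y - 1), poch, sub_add_cancel]; ring

/-- being a polynomial function -/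
def IsPolyFun (f : ℂ → ℂ) : Prop := ∃ p : Polynomial ℂ, ∀ x, f x = p.eval x

theorem isPolyFun_poch (s : ℂ) (m : ℕ) : IsPolyFun (fun x => poch (x + s) m) := by
  induction m with
  | zero => exact ⟨1, fun x => by simp [poch]⟩
  | succ m ih =>
    obtain ⟨p, hp⟩ := ih
    refine ⟨p * (Polynomial.X + Polynomial.C (s + m)), fun x => ?_⟩
    have := hp x
    simp only at this
    simp only [poch, this, Polynomial.eval_mul, Polynomial.eval_add, Polynomial.eval_X,
      Polynomial.eval_C]
    ring

theorem isPolyFun_sum (N : ℕ) (A B : ℕ → ℂ) (f : ℕ → ℂ → ℂ) (h : ∀ m, IsPolyFun (f m)) :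
    IsPolyFun (fun x => ∑ m ∈ Finset.range N, A m * f m x * B m) := by
  choose p hp using h
  refine ⟨∑ m ∈ Finset.range N, Polynomial.C (A m) * p m * Polynomial.C (B m), fun x => ?_⟩
  simp [Polynomial.eval_finsetSum, hp]

theorem isPolyFun_ext (f g : ℂ → ℂ) (hf : IsPolyFun f) (hg : IsPolyFun g)
    (h : ∀ k : ℕ, f k = g k) (x : ℂ) : f x = g x := by
  obtain ⟨p, hp⟩ := hf
  obtain ⟨q, hq⟩ := hg
  have : p = q := by
    apply Polynomial.eq_of_infinite_eval_eq
    apply Set.Infinite.mono (s := Set.range (fun k : ℕ => (k : ℂ)))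
    · rintro _ ⟨k, rfl⟩
      simp only [Set.mem_ofPred_eq, ← hp, ← hq, h]
    · exact Set.infinite_range_of_injective Nat.cast_injective
  rw [hp, hq, this]

/-- if two polynomial functions agree at one natural point and have the same backward
differences, they agree -/
theorem isPolyFun_ext_nabla (f g : ℂ → ℂ) (hf : IsPolyFun f) (hg : IsPolyFun g)
    (h0 : f 0 = g 0) (h : ∀ x, f x - f (x - 1) = g x - g (x - 1)) (x : ℂ) : f x = g x := by
  apply isPolyFun_ext f g hf hg
  intro k
  induction k with
  | zero => simpa using h0
  | succ k ih =>
    have := h ((k + 1 : ℕ) : ℂ)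
    have e : (((k + 1 : ℕ) : ℂ) - 1) = k := by push_cast; ring
    rw [e, ih] at this
    linear_combination this

/-- first sum -/
noncomputable def sumS (n : ℕ) (x c : ℂ) : ℂ :=
  ∑ m ∈ Finset.range (n + 1),
    (n.choose m : ℂ) * poch (x - (m / 2 : ℕ)) m * poch (c + ((m + 1) / 2 : ℕ)) (n - m)

/-- second sum (shifted by one in `x`) -/
noncomputable def sumT (n : ℕ) (x c : ℂ) : ℂ :=
  ∑ m ∈ Finset.range (n + 1),
    (n.choose m : ℂ) * poch (x + 1 - ((m + 1) / 2 : ℕ)) m * poch (c + (m / 2 : ℕ)) (n - m)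

theorem choose_aux (n m : ℕ) :
    ((n + 1).choose (m + 1) : ℂ) * ((m : ℂ) + 1) = ((n : ℂ) + 1) * (n.choose m : ℂ) := by
  have := Nat.add_one_mul_choose_eq n m
  exact_mod_cast this.symm

theorem sumS_nabla (n : ℕ) (x c : ℂ) :
    sumS (n + 1) x c - sumS (n + 1) (x - 1) c = ((n : ℂ) + 1) * sumT n (x - 1) (c + 1) := by
  unfold sumS sumT
  rw [← Finset.sum_sub_distrib, Finset.sum_range_succ', Finset.mul_sum]
  simp only [poch]
  rw [show ∀ a b : ℂ, a * 1 * b - a * 1 * b = 0 from fun a b => by ring, add_zero]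
  refine Finset.sum_congr rfl fun m _ => ?_
  have h1 := poch_nabla (x - ((m + 1) / 2 : ℕ)) m
  have h2 := choose_aux n m
  rw [show (m + 1 + 1) / 2 = m / 2 + 1 by omega, show n + 1 - (m + 1) = n - m by omega,
    show x - 1 + 1 - (((m + 1) / 2 : ℕ) : ℂ) = x - ((m + 1) / 2 : ℕ) by ring,
    show x - 1 - (((m + 1) / 2 : ℕ) : ℂ) = x - ((m + 1) / 2 : ℕ) - 1 by ring,
    show c + ((m / 2 + 1 : ℕ) : ℂ) = c + 1 + (m / 2 : ℕ) by push_cast; ring]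
  simp only [poch] at h1
  generalize poch (c + 1 + (m / 2 : ℕ)) (n - m) = P at *
  generalize poch (x - ((m + 1) / 2 : ℕ)) m = Q at *
  linear_combination ((n + 1).choose (m + 1) : ℂ) * P * h1 + Q * P * h2

theorem sumT_nabla (n : ℕ) (x c : ℂ) :
    sumT (n + 1) x c - sumT (n + 1) (x - 1) c = ((n : ℂ) + 1) * sumS n x c := by
  unfold sumS sumT
  rw [← Finset.sum_sub_distrib, Finset.sum_range_succ', Finset.mul_sum]
  simp only [poch]
  rw [show ∀ a b : ℂ, a * 1 * b - a * 1 * b = 0 from fun a b => by ring, add_zero]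
  refine Finset.sum_congr rfl fun m _ => ?_
  have h1 := poch_nabla (x - (m / 2 : ℕ)) m
  have h2 := choose_aux n m
  rw [show (m + 1 + 1) / 2 = m / 2 + 1 by omega, show n + 1 - (m + 1) = n - m by omega,
    show x + 1 - ((m / 2 + 1 : ℕ) : ℂ) = x - (m / 2 : ℕ) by push_cast; ring,
    show x - 1 + 1 - ((m / 2 + 1 : ℕ) : ℂ) = x - (m / 2 : ℕ) - 1 by push_cast; ring]
  simp only [poch] at h1
  generalize poch (c + ((m + 1) / 2 : ℕ)) (n - m) = P at *
  generalize poch (x - (m / 2 : ℕ)) m = Q at *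
  linear_combination ((n + 1).choose (m + 1) : ℂ) * P * h1 + Q * P * h2

theorem poch_neg_eq_zero (i m : ℕ) (h : i < m) : poch (0 - (i : ℂ)) m = 0 := by
  obtain ⟨d, rfl⟩ := Nat.exists_eq_add_of_lt h
  rw [show i + d + 1 = i + 1 + d by ring, poch_add, poch]
  simp

theorem sumS_zero (n : ℕ) (c : ℂ) : sumS n 0 c = poch c n := by
  unfold sumS
  rw [Finset.sum_range_succ', Finset.sum_eq_zero]
  · simp [poch]
  · intro m _
    rw [poch_neg_eq_zero _ _ (by omega)]; simp

theorem sumT_zero (n : ℕ) (c : ℂ) : sumT n 0 c = poch c n := by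
  unfold sumT
  rw [Finset.sum_range_succ', Finset.sum_eq_zero]
  · simp [poch]
  · intro m _
    rw [show (m + 1 + 1) / 2 = m / 2 + 1 by omega,
      show (0 : ℂ) + 1 - ((m / 2 + 1 : ℕ) : ℂ) = 0 - (m / 2 : ℕ) by push_cast; ring,
      poch_neg_eq_zero _ _ (by omega)]; simp

theorem isPolyFun_sumS (n : ℕ) (c : ℂ) : IsPolyFun (fun x => sumS n x c) := by
  unfold sumS
  refine isPolyFun_sum (n + 1) (fun m => (n.choose m : ℂ))
    (fun m => poch (c + ((m + 1) / 2 : ℕ)) (n - m)) (fun m x => poch (x - (m / 2 : ℕ)) m) ?_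
  intro m
  simpa only [sub_eq_add_neg] using isPolyFun_poch (-((m / 2 : ℕ) : ℂ)) m

theorem isPolyFun_sumT (n : ℕ) (c : ℂ) : IsPolyFun (fun x => sumT n x c) := by
  unfold sumT
  refine isPolyFun_sum (n + 1) (fun m => (n.choose m : ℂ))
    (fun m => poch (c + (m / 2 : ℕ)) (n - m)) (fun m x => poch (x + 1 - ((m + 1) / 2 : ℕ)) m) ?_
  intro m
  simpa only [sub_eq_add_neg, add_assoc] using isPolyFun_poch (1 + -(((m + 1) / 2 : ℕ) : ℂ)) m

theorem sumST (n : ℕ) : (∀ x c, sumS n x c = poch (x + c) n) ∧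
    (∀ x c, sumT n x c = poch (x + c) n) := by
  induction n with
  | zero => constructor <;> intro x c <;> simp [sumS, sumT, poch]
  | succ n ih =>
    constructor
    · intro x c
      apply isPolyFun_ext_nabla (fun x => sumS (n + 1) x c) (fun x => poch (x + c) (n + 1))
        (isPolyFun_sumS _ _) (isPolyFun_poch _ _)
      · simp [sumS_zero]
      · intro x
        rw [sumS_nabla, ih.2, show x - 1 + c = x + c - 1 by ring, poch_nabla]
        congr 2; ring
    · intro x c
      apply isPolyFun_ext_nabla (fun x => sumT (n + 1) x c) (fun x => poch (x + c) (n + 1))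
        (isPolyFun_sumT _ _) (isPolyFun_poch _ _)
      · simp [sumT_zero]
      · intro x
        rw [sumT_nabla, ih.1, show x - 1 + c = x + c - 1 by ring, poch_nabla]

theorem sum_pairs (f : ℕ → ℂ) (N : ℕ) :
    ∑ m ∈ Finset.range (2 * N), f m = ∑ k ∈ Finset.range N, (f (2 * k) + f (2 * k + 1)) := by
  induction N with
  | zero => simp
  | succ N ih =>
    rw [show 2 * (N + 1) = 2 * N + 1 + 1 by ring, Finset.sum_range_succ, Finset.sum_range_succ,
      Finset.sum_range_succ, ih]; ring

theorem sumS_pairs (n : ℕ) (x c : ℂ) : poch (x + c) n =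
    ∑ k ∈ Finset.range (n / 2 + 1),
      ((n.choose (2 * k) : ℂ) * poch (x - k) (2 * k) * poch (c + k) (n - 2 * k) +
       (n.choose (2 * k + 1) : ℂ) * poch (x - k) (2 * k + 1) *
          poch (c + k + 1) (n - (2 * k + 1))) := by
  rw [← (sumST n).1, sumS]
  have hsub : Finset.range (n + 1) ⊆ Finset.range (2 * (n / 2 + 1)) := by
    intro m hm
    simp only [Finset.mem_range] at *
    omega
  rw [Finset.sum_subset hsub, sum_pairs]
  · refine Finset.sum_congr rfl fun k _ => ?_
    rw [show 2 * k / 2 = k by omega, show (2 * k + 1) / 2 = k by omega,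
      show (2 * k + 1 + 1) / 2 = k + 1 by omega]
    push_cast
    rw [add_assoc c]
  · intro m _ hm
    simp only [Finset.mem_range] at hm
    rw [Nat.choose_eq_zero_of_lt (by omega)]; simp

theorem poch_center (a : ℂ) (k : ℕ) :
    poch (1 - a - k) (2 * k) = (-1) ^ k * (poch a k * poch (1 - a) k) := by
  induction k with
  | zero => simp [poch]
  | succ k ih =>
    rw [show 2 * (k + 1) = 2 * k + 1 + 1 by ring, poch_succ_left,
      show 1 - a - ((k + 1 : ℕ) : ℂ) + 1 = 1 - a - k by push_cast; ring, poch, ih, poch, poch]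
    push_cast
    ring

theorem poch_reflect (y : ℂ) (k : ℕ) : poch (1 - y - k) k = (-1) ^ k * poch y k := by
  induction k with
  | zero => simp [poch]
  | succ k ih =>
    rw [poch_succ_left, show 1 - y - ((k + 1 : ℕ) : ℂ) + 1 = 1 - y - k by push_cast; ring, ih, poch]
    push_cast
    ring

theorem poch_half (n k : ℕ) (h : 2 * k ≤ n) :
    poch (-(n : ℂ) / 2) k * poch ((1 - (n : ℂ)) / 2) k * 4 ^ k * ((n - 2 * k).factorial : ℂ)
      = (n.factorial : ℂ) := by
  induction k with
  | zero => simp [poch]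
  | succ k ih =>
    rw [← ih (by omega)]
    obtain ⟨r, rfl⟩ := Nat.exists_eq_add_of_le h
    rw [show 2 * (k + 1) + r - 2 * (k + 1) = r by omega,
      show 2 * (k + 1) + r - 2 * k = r + 1 + 1 by omega, poch, poch, Nat.factorial_succ,
      Nat.factorial_succ]
    push_cast
    ring

theorem poch_threehalves (k : ℕ) :
    poch (3 / 2) k * (k.factorial : ℂ) * 4 ^ k = ((2 * k + 1).factorial : ℂ) := by
  induction k with
  | zero => simp [poch]
  | succ k ih =>
    rw [show 2 * (k + 1) + 1 = 2 * k + 1 + 1 + 1 by ring, Nat.factorial_succ (2 * k + 1 + 1),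
      Nat.factorial_succ (2 * k + 1), poch, Nat.factorial_succ k]
    push_cast
    rw [← ih]
    ring

/-- the numerical coefficient -/
theorem coeff_eq (n k : ℕ) (h : 2 * k ≤ n) :
    ∃ B : ℂ, poch (-(n : ℂ) / 2) k * poch ((1 - (n : ℂ)) / 2) k
        = B * (poch (3 / 2) k * (k.factorial : ℂ)) ∧
      B * (2 * k + 1) = (n.choose (2 * k) : ℂ) ∧
      B * ((n : ℂ) - 2 * k) = (n.choose (2 * k + 1) : ℂ) := by
  have h1 := poch_half n k h
  have h2 := poch_threehalves k
  have h4 : (4 : ℂ) ^ k ≠ 0 := pow_ne_zero _ (by norm_num)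
  have hf : ((2 * k).factorial : ℂ) ≠ 0 := by exact_mod_cast Nat.factorial_ne_zero _
  have hg : ((n - 2 * k).factorial : ℂ) ≠ 0 := by exact_mod_cast Nat.factorial_ne_zero _
  have hk : (2 * (k : ℂ) + 1) ≠ 0 := by exact_mod_cast Nat.succ_ne_zero (2 * k)
  have h5 : ((n.choose (2 * k) : ℕ) : ℂ) * (2 * k).factorial * (n - 2 * k).factorial
      = n.factorial := by exact_mod_cast Nat.choose_mul_factorial_mul_factorial h
  have h6 : ((n.choose (2 * k + 1) : ℕ) : ℂ) * (2 * k + 1) = n.choose (2 * k) * ((n : ℂ) - 2 * k) := by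
    have := Nat.choose_succ_right_eq n (2 * k)
    have h7 : ((n - 2 * k : ℕ) : ℂ) = (n : ℂ) - 2 * k := by
      rw [Nat.cast_sub h]; push_cast; ring
    rw [← h7]
    exact_mod_cast this
  refine ⟨(n.choose (2 * k) : ℂ) / (2 * k + 1), ?_, ?_, ?_⟩
  · rw [Nat.factorial_succ] at h2
    push_cast at h2
    rw [div_mul_eq_mul_div, eq_div_iff hk]
    apply mul_right_cancel₀ h4
    apply mul_right_cancel₀ hg
    linear_combination (2 * (k : ℂ) + 1) * h1 - (2 * (k : ℂ) + 1) * h5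
      - (n.choose (2 * k) : ℂ) * ((n - 2 * k).factorial : ℂ) * h2
  · field_simp
  · field_simp
    linear_combination -h6

/-- Terminating balanced ₅F₄-series identity (second-type CVG corollary, second form). -/
theorem cvg_balanced_5F4_second (n : ℕ) (a c : ℂ) (v : ℂ)
    (hv : v = (c + (n : ℂ) - a * (n : ℂ)) / (2 * a + 2 * c + (n : ℂ) - 1))
    (hden : 2 * a + 2 * c + (n : ℂ) - 1 ≠ 0)
    (hnum : c + (n : ℂ) - a * (n : ℂ) ≠ 0)
    (hvj : ∀ j : ℕ, j < n / 2 → v + (j : ℂ) ≠ 0)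
    (hc : ∀ j : ℕ, j < n → c + 1 + (j : ℂ) ≠ 0)
    (hcn : ∀ j : ℕ, j < n / 2 → 1 - c - (n : ℂ) + (j : ℂ) ≠ 0) :
    ∑ k ∈ Finset.range (n / 2 + 1),
      poch (-(n : ℂ) / 2) k * poch ((1 - (n : ℂ)) / 2) k * poch (1 + v) k *
        poch a k * poch (1 - a) k /
        (poch (3 / 2) k * poch v k * poch (c + 1) k * poch (1 - c - (n : ℂ)) k *
          (Nat.factorial k : ℂ)) =
      ((c + (n : ℂ)) / (c + (n : ℂ) - a * (n : ℂ))) * (poch (c + 1 - a) n / poch (c + 1) n) := by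
  rw [show c + 1 - a = (1 - a) + c by ring, sumS_pairs, Finset.sum_div, Finset.mul_sum]
  refine Finset.sum_congr rfl fun k hk => ?_
  have hk2 : k ≤ n / 2 := by simpa [Nat.lt_succ_iff] using hk
  have hkn : 2 * k ≤ n := by omega
  obtain ⟨B, hB, hB1, hB2⟩ := coeff_eq n k hkn
  have hT : poch (3 / 2) k * (k.factorial : ℂ) ≠ 0 := by
    intro h0
    have := poch_threehalves k
    rw [h0, zero_mul] at this
    exact Nat.factorial_ne_zero (2 * k + 1) (by exact_mod_cast this.symm)
  have hV : poch v k ≠ 0 := poch_ne_zero _ _ fun j hj => hvj j (by omega)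
  have hV2 : poch (1 + v) k * (c + n - a * n) =
      poch v k * ((c + n - a * n) + k * (2 * a + 2 * c + n - 1)) := by
    have h1 : poch v (k + 1) = v * poch (v + 1) k := poch_succ_left v k
    rw [poch, add_comm v 1] at h1
    have h2 : v * (2 * a + 2 * c + n - 1) = c + n - a * n := by rw [hv]; exact div_mul_cancel₀ _ hden
    linear_combination (-(2 * a + 2 * c + n - 1)) * h1 - poch (1 + v) k * h2 + poch v k * h2
  have hD : poch (c + 1) k ≠ 0 := poch_ne_zero _ _ fun j hj => hc j (by omega)
  have hN : poch (c + 1) n ≠ 0 := poch_ne_zero _ _ hc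
  have hM' : poch (1 - c - n) k ≠ 0 := poch_ne_zero _ _ fun j hj => hcn j (by omega)
  rw [poch, poch_center]
  obtain ⟨r, rfl⟩ := Nat.exists_eq_add_of_le hkn
  have hR : poch (1 - c - ((2 * k + r : ℕ) : ℂ)) k = (-1) ^ k * poch (c + k + r) k := by
    rw [← poch_reflect]; congr 1; push_cast; ring
  have hsg : ((-1 : ℂ) ^ k) * (-1) ^ k = 1 := by rw [← mul_pow]; simp
  have hsplit : poch (c + 1) (2 * k + r) =
      poch (c + 1) k * poch (c + k + 1) r * poch (c + k + r + 1) k := by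
    rw [show 2 * k + r = k + r + k by ring, poch_add, poch_add]
    push_cast
    rw [show c + 1 + (k : ℂ) = c + k + 1 by ring, show c + 1 + ((k : ℂ) + r) = c + k + r + 1 by ring]
  have hE : (c + k + r) * poch (c + k + r + 1) k
      = poch (c + k + r) k * (c + ((2 * k + r : ℕ) : ℂ)) := by
    rw [← poch_succ_left, poch]; push_cast; ring
  have hckr : c + k + r ≠ 0 := by
    rcases Nat.eq_zero_or_pos (k + r) with h0 | h0
    · have hk0 : k = 0 := by omega
      have hr0 : r = 0 := by omega
      subst hk0; subst hr0
      simpa using hnum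
    · have := hc (k + r - 1) (by omega)
      rw [Nat.cast_sub (by omega)] at this
      push_cast at this
      intro h0
      apply this
      linear_combination h0
  -- the key normal form
  have key : poch (c + 1) (2 * k + r) * ((c + k) * B * (2 * k + 1) + B * r * (1 - a + k)) *
        poch (c + k + r) k ^ 0 =
      poch (c + 1) k * poch (c + k + r) k * (c + ((2 * k + r : ℕ) : ℂ)) *
      (((2 * k + r).choose (2 * k) : ℂ) * poch (c + k) (2 * k + r - 2 * k) +
       ((2 * k + r).choose (2 * k + 1) : ℂ) * (1 - a + k) *
          poch (c + k + 1) (2 * k + r - (2 * k + 1))) := by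
    rw [hsplit, ← hB1, ← hB2, pow_zero, mul_one]
    cases r with
    | zero =>
      simp only [Nat.cast_zero, add_zero, Nat.sub_self] at *
      simp only [poch]
      push_cast at *
      linear_combination (poch (c + 1) k * B * (2 * k + 1)) * hE
    | succ r =>
      rw [show 2 * k + (r + 1) - 2 * k = r + 1 by omega,
        show 2 * k + (r + 1) - (2 * k + 1) = r by omega, poch_succ_left (c + k), poch]
      push_cast at *
      linear_combination (poch (c + 1) k * poch (c + k + 1) r * B *
        ((c + k) * (2 * k + 1) + (r + 1) * (1 - a + k))) * hE
  rw [hR] at hM' ⊢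
  rw [pow_zero, mul_one] at key
  have hM : poch (c + k + r) k ≠ 0 := right_ne_zero_of_mul hM'
  have hT1 := left_ne_zero_of_mul hT
  have hT2 := right_ne_zero_of_mul hT
  have hs : ((-1 : ℂ) ^ k) ≠ 0 := left_ne_zero_of_mul hM'
  have hlin : (c + ((2 * k + r : ℕ) : ℂ) - a * ((2 * k + r : ℕ) : ℂ)) +
      k * (2 * a + 2 * c + ((2 * k + r : ℕ) : ℂ) - 1) =
      (c + k) * (2 * k + 1) + r * (1 - a + k) := by push_cast; ring
  rw [hlin] at hV2
  rw [hB, div_mul_div_comm, div_eq_div_iff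
    (mul_ne_zero (mul_ne_zero (mul_ne_zero (mul_ne_zero hT1 hV) hD) hM') hT2)
    (mul_ne_zero hnum hN)]
  generalize hch1 : (((2 * k + r).choose (2 * k) : ℕ) : ℂ) = C1 at *
  generalize hch2 : (((2 * k + r).choose (2 * k + 1) : ℕ) : ℂ) = C2 at *
  generalize poch (c + k) (2 * k + r - 2 * k) = P1 at *
  generalize poch (c + k + 1) (2 * k + r - (2 * k + 1)) = P2 at *
  generalize poch (c + 1) (2 * k + r) = PN at *
  generalize poch (c + k + r) k = M at *
  generalize poch (c + 1) k = D at *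
  generalize poch (1 + v) k = V1 at *
  generalize poch v k = V at *
  generalize poch (3 / 2) k = T at *
  generalize (k.factorial : ℂ) = F at *
  generalize poch a k = A1 at *
  generalize poch (1 - a) k = A2 at *
  generalize ((-1 : ℂ) ^ k) = s at *
  push_cast at *
  linear_combination (B * T * F * A1 * A2 * PN) * hV2 + T * F * A1 * A2 * V * key -
    (c + (2 * k + r)) * T * F * A1 * A2 * V * D * M * (C1 * P1 + C2 * P2 * (1 - a + k)) * hsg
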